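/- arXiv:2002.07680 — 13 statements merged into one kernel-verified Lean document; each statement's English description precedes it below -/
import Mathlib

section
/- Let 𝔽 be a closure system on a finite set S and suppose 𝔽_max is a largest extension of 𝔽, i.e. 𝔽_max is an extension of 𝔽 and every extension of 𝔽 is contained in 𝔽_max. Then ∅ ∈ 𝔽_max. (Consequently, no implicational base of 𝔽_max contains a nontrivial implication with empty premise.) -/
/-!
Common framework: the finite ground set `S` is modelled as a finite type `α`;
subsets of `S` are terms of `Set α`, and the full set `S` is `Set.univ`.
-/

universe u

variable {α : Type u}

/-- A closure system on the finite ground set `α`: it contains the ground set and is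
closed under pairwise intersection. -/
def IsClosureSystem (F : Set (Set α)) : Prop :=
  Set.univ ∈ F ∧ ∀ X ∈ F, ∀ Y ∈ F, X ∩ Y ∈ F

/-- The closure operator of a family `F`: `clOp F X` is the intersection of all
members of `F` containing `X` (the smallest member of `F` containing `X`). -/
def clOp (F : Set (Set α)) (X : Set α) : Set α :=
  ⋂₀ {A | A ∈ F ∧ X ⊆ A}

/-- `F'` is an extension of the closure system `F`: a closure system containing `F`
whose closure operator agrees with that of `F` on unions of members of `F`. -/
def IsExtension (F F' : Set (Set α)) : Prop :=
  IsClosureSystem F' ∧ F ⊆ F' ∧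
    ∀ X ∈ F, ∀ Y ∈ F, clOp F (X ∪ Y) = clOp F' (X ∪ Y)

/-- `X` is closed for the implicational base `T` (a set of implications `L → R`,
encoded as pairs `(L, R)`). -/
def ImpClosed (T : Set (Set α × Set α)) (X : Set α) : Prop :=
  ∀ p ∈ T, p.1 ⊆ X → p.2 ⊆ X

/-- The family of `T`-closed sets. -/
def impClosedSets (T : Set (Set α × Set α)) : Set (Set α) :=
  {X | ImpClosed T X}

/-- `X^T`, the smallest `T`-closed set containing `X`. -/
def impCl (T : Set (Set α × Set α)) (X : Set α) : Set α :=
  ⋂₀ {A | ImpClosed T A ∧ X ⊆ A}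

/-- The set `Σ_u` of unitary implications `{x} → Φ({x})` for `x ∈ U_Φ`, where `Φ` is
the closure operator of `F` and `U_Φ = {x | Φ({x}) ≠ {x}}`. -/
def unitaryBase (F : Set (Set α)) : Set (Set α × Set α) :=
  {p | ∃ x : α, clOp F {x} ≠ {x} ∧ p = ({x}, clOp F {x})}

/-- `Δ_x(F) = {A ∈ F | Φ_*(x) ⊄ A}`, where `Φ_*(x) = Φ({x}) \ {x}`. -/
def deltaF (F : Set (Set α)) (x : α) : Set (Set α) :=
  {A | A ∈ F ∧ ¬ clOp F {x} \ {x} ⊆ A}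

/-- `Δᶜ_x(F) = {A ∪ {x} | A ∈ Δ_x(F)}`. -/
def deltaC (F : Set (Set α)) (x : α) : Set (Set α) :=
  {B | ∃ A ∈ deltaF F x, B = A ∪ {x}}

/-- One step of the extension construction: `F ↦ F ∪ Δᶜ_x(F)`. -/
def extStep (F : Set (Set α)) (x : α) : Set (Set α) :=
  F ∪ deltaC F x

/-- `M` is meet-irreducible in the family `G`: `M ∈ G`, `M ≠ S`, and `M` is not a
proper intersection of two members of `G`. -/
def MeetIrred (G : Set (Set α)) (M : Set α) : Prop :=
  M ∈ G ∧ M ≠ Set.univ ∧ ∀ X ∈ G, ∀ Y ∈ G, M = X ∩ Y → M = X ∨ M = Y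

/-- The unique cover `M* = ⋂ {A ∈ F | M ⊊ A}` of a meet-irreducible `M` of `F`. -/
def coverSet (F : Set (Set α)) (M : Set α) : Set α :=
  ⋂₀ {A | A ∈ F ∧ M ⊂ A}

/-- `B` is a cover of `A` in the family `G`: `B ∈ G`, `A ⊊ B`, and no member of `G`
lies strictly between them. -/
def CoverIn (G : Set (Set α)) (A B : Set α) : Prop :=
  B ∈ G ∧ A ⊂ B ∧ ∀ C ∈ G, ¬(A ⊂ C ∧ C ⊂ B)

/-- `𝕄¹`: meet-irreducibles of `F` containing `Φ({x})`. -/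
def mm1 (F : Set (Set α)) (x : α) : Set (Set α) :=
  {M | MeetIrred F M ∧ clOp F {x} ⊆ M}

/-- `𝕄²`: meet-irreducibles of `F` containing `Φ_*(x)` but not `x`. -/
def mm2 (F : Set (Set α)) (x : α) : Set (Set α) :=
  {M | MeetIrred F M ∧ clOp F {x} \ {x} ⊆ M ∧ x ∉ M}

/-- `𝕄³`: meet-irreducibles `M` of `F` with `Φ_*(x) ⊄ M` and `x ∈ M*`. -/
def mm3 (F : Set (Set α)) (x : α) : Set (Set α) :=
  {M | MeetIrred F M ∧ ¬ clOp F {x} \ {x} ⊆ M ∧ x ∈ coverSet F M}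

/-- `𝕄⁴`: meet-irreducibles `M` of `F` with `Φ_*(x) ⊄ M`, `x ∉ M*` and `Φ_*(x) ⊆ M*`. -/
def mm4 (F : Set (Set α)) (x : α) : Set (Set α) :=
  {M | MeetIrred F M ∧ ¬ clOp F {x} \ {x} ⊆ M ∧ x ∉ coverSet F M ∧
    clOp F {x} \ {x} ⊆ coverSet F M}

/-- `𝕄⁵`: meet-irreducibles `M` of `F` with `Φ_*(x) ⊄ M`, `x ∉ M*` and `Φ_*(x) ⊄ M*`. -/
def mm5 (F : Set (Set α)) (x : α) : Set (Set α) :=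
  {M | MeetIrred F M ∧ ¬ clOp F {x} \ {x} ⊆ M ∧ x ∉ coverSet F M ∧
    ¬ clOp F {x} \ {x} ⊆ coverSet F M}

/-- `𝕄⁶`: members of `Δ_x(F)` that are not meet-irreducible in `F`, have exactly one
cover `B` in `Δ_x(F)`, and satisfy `Φ(A ∪ {x}) = Φ(B ∪ {x})`. -/
def mm6 (F : Set (Set α)) (x : α) : Set (Set α) :=
  {A | A ∈ deltaF F x ∧ ¬ MeetIrred F A ∧
    ∃ B, CoverIn (deltaF F x) A B ∧ (∀ C, CoverIn (deltaF F x) A C → C = B) ∧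
      clOp F (A ∪ {x}) = clOp F (B ∪ {x})}
/-- the largest extension contains the empty set. -/
theorem empty_mem_largest_extension {α : Type u} [Fintype α]
    (F Fmax : Set (Set α)) (hF : IsClosureSystem F)
    (hext : IsExtension F Fmax)
    (hlargest : ∀ F' : Set (Set α), IsExtension F F' → F' ⊆ Fmax) :
    (∅ : Set α) ∈ Fmax := by
  refine hlargest (insert ∅ F) ⟨⟨Or.inr hF.1, ?_⟩, Set.subset_insert _ _, ?_⟩ (Set.mem_insert _ _)
  · rintro X (rfl | hX) Y (rfl | hY)
    · simp
    · simp
    · simp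
    · exact Or.inr (hF.2 X hX Y hY)
  · intro X hX Y hY
    unfold clOp
    congr 1
    ext A
    constructor
    · rintro ⟨hA, h⟩
      exact ⟨Or.inr hA, h⟩
    · rintro ⟨rfl | hA, h⟩
      · have hX0 : X = ∅ := Set.subset_empty_iff.mp (Set.subset_union_left.trans h)
        exact ⟨hX0 ▸ hX, h⟩
      · exact ⟨hA, h⟩
end

section
/- Let 𝔽 be a closure system on a finite set S, let 𝔽' be an extension of 𝔽 with ∅ ∈ 𝔽', and let x ∈ S. Then 𝔽' ∪ {{x}} is also an extension of 𝔽. -/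
/-!
Common framework: the finite ground set `S` is modelled as a finite type `α`;
subsets of `S` are terms of `Set α`, and the full set `S` is `Set.univ`.
-/

universe u

variable {α : Type u}

/-- if `F'` is an extension of `F` containing `∅`, then `F' ∪ {{x}}`
is also an extension of `F`, for any `x ∈ S`. -/
theorem extension_union_singleton {α : Type u} [Fintype α]
    (F F' : Set (Set α)) (hF : IsClosureSystem F) (hext : IsExtension F F')
    (hempty : (∅ : Set α) ∈ F') (x : α) :
    IsExtension F (F' ∪ {({x} : Set α)}) := by
  obtain ⟨⟨huniv, hinter⟩, hsub, hcl⟩ := hext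
  have key : ∀ Z ∈ F', Z ∩ {x} ∈ F' ∪ {({x} : Set α)} := by
    intro Z _
    by_cases hx : x ∈ Z
    · right
      exact Set.inter_eq_right.mpr (Set.singleton_subset_iff.mpr hx)
    · left
      rw [Set.inter_singleton_eq_empty.mpr hx]
      exact hempty
  refine ⟨⟨Or.inl huniv, ?_⟩, fun A hA => Or.inl (hsub hA), ?_⟩
  · rintro X (hX | rfl) Y (hY | rfl)
    · exact Or.inl (hinter X hX Y hY)
    · exact key X hX
    · rw [Set.inter_comm]
      exact key Y hY
    · right
      exact Set.inter_self _
  · intro X hX Y hY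
    rw [hcl X hX Y hY]
    apply Set.Subset.antisymm
    · rintro a ha A ⟨hA | rfl, hXA⟩
      · exact ha A ⟨hA, hXA⟩
      · have hmem : X ∪ Y ∈ F' := by
          rcases Set.subset_singleton_iff_eq.mp (Set.union_subset_iff.mp hXA).1 with h | h
          · rw [h, Set.empty_union]
            exact hsub hY
          · rw [Set.union_eq_left.mpr (h ▸ (Set.union_subset_iff.mp hXA).2)]
            exact hsub hX
        exact hXA (ha _ ⟨hmem, subset_rfl⟩)
    · rintro a ha A ⟨hA, hXA⟩
      exact ha A ⟨Or.inl hA, hXA⟩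
end

section
/- Let 𝔽 be a closure system on a finite set S and suppose 𝔽_max is a largest extension of 𝔽, i.e. 𝔽_max is an extension of 𝔽 and every extension of 𝔽 is contained in 𝔽_max. Then {x} ∈ 𝔽_max for every x ∈ S; that is, the largest extension is atomistic. (Consequently, no implicational base of 𝔽_max contains a nontrivial unitary implication.) -/
/-!
Common framework: the finite ground set `S` is modelled as a finite type `α`;
subsets of `S` are terms of `Set α`, and the full set `S` is `Set.univ`.
-/

universe u

variable {α : Type u}

/-- the largest extension is atomistic: it contains every singleton. -/
theorem singleton_mem_largest_extension {α : Type u} [Fintype α]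
    (F Fmax : Set (Set α)) (hF : IsClosureSystem F)
    (hext : IsExtension F Fmax)
    (hlargest : ∀ F' : Set (Set α), IsExtension F F' → F' ⊆ Fmax) :
    ∀ x : α, ({x} : Set α) ∈ Fmax := by
  intro x
  refine hlargest {X | ∀ A ∈ F, ∀ B ∈ F, A ∪ B ⊆ X → clOp F (A ∪ B) ⊆ X} ⟨⟨?_, ?_⟩, ?_, ?_⟩ ?_
  · intro A _ B _ _
    exact Set.subset_univ _
  · intro X hX Y hY A hA B hB h
    exact Set.subset_inter (hX A hA B hB (h.trans Set.inter_subset_left))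
      (hY A hA B hB (h.trans Set.inter_subset_right))
  · intro X hX A _ B _ h
    exact Set.sInter_subset_of_mem ⟨hX, h⟩
  · intro A hA B hB
    apply Set.Subset.antisymm
    · exact Set.subset_sInter fun C hC => hC.1 A hA B hB hC.2
    · refine Set.subset_sInter fun C hC => Set.sInter_subset_of_mem ⟨?_, hC.2⟩
      intro A' _ B' _ h
      exact Set.sInter_subset_of_mem ⟨hC.1, h⟩
  · intro A hA B hB h
    have key : A ∪ B ∈ F := by
      rcases Set.subset_singleton_iff_eq.1 (Set.subset_union_left.trans h) with h1 | h1
      · rw [h1, Set.empty_union]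
        exact hB
      · have hBA : B ⊆ A := by
          rw [h1]
          exact Set.subset_union_right.trans h
        rw [Set.union_eq_self_of_subset_right hBA]
        exact hA
    have h2 : clOp F (A ∪ B) ⊆ A ∪ B := Set.sInter_subset_of_mem ⟨key, subset_rfl⟩
    exact h2.trans h
end

section
/- Let Σ be an implicational base of a closure system 𝔽 on a finite set S, with Σ = Σ_u ∪ Σ_nu as described. If Σ is ideal-closed and condition (*) holds, then the family 𝔽_nu of Σ_nu-closed sets is an extension of 𝔽; in particular, for all X, Y ∈ 𝔽, Φ_nu(X ∪ Y) = Φ(X ∪ Y). -/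
/-!
Common framework: the finite ground set `S` is modelled as a finite type `α`;
subsets of `S` are terms of `Set α`, and the full set `S` is `Set.univ`.
-/

universe u

variable {α : Type u}

/-- if `Σ` is ideal-closed and condition (*) holds, then `𝔽_nu` is an
extension of `𝔽`; in particular `Φ_nu(X ∪ Y) = Φ(X ∪ Y)` for all `X, Y ∈ 𝔽`. -/
theorem nonunitary_closedSets_isExtension {α : Type u} [Fintype α]
    (T : Set (Set α × Set α)) (F : Set (Set α))
    (hF : F = impClosedSets T)
    (hu : unitaryBase F ⊆ T)
    (hnu : ∀ p ∈ T \ unitaryBase F, 1 < p.1.ncard)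
    (hideal : ∀ p ∈ T \ unitaryBase F,
      ImpClosed (unitaryBase F) (impCl (T \ unitaryBase F) p.1))
    (hstar : ∀ p ∈ T \ unitaryBase F, ∀ x ∈ p.1,
      clOp F {x} \ {x} ⊆ impCl (T \ unitaryBase F) (p.1 \ {x})) :
    IsExtension F (impClosedSets (T \ unitaryBase F)) ∧
      ∀ X ∈ F, ∀ Y ∈ F,
        impCl (T \ unitaryBase F) (X ∪ Y) = clOp F (X ∪ Y) := by
  classical
  have hle : ∀ A, A ∈ F → ImpClosed (T \ unitaryBase F) A := by
    intro A hA p hp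
    rw [hF] at hA
    exact hA p hp.1
  have hclosed : ∀ Z, ImpClosed (T \ unitaryBase F) (impCl (T \ unitaryBase F) Z) := by
    intro Z p hp hpZ r hr A hA
    exact hA.1 p hp (fun y hy => hpZ hy A hA) hr
  have hsub : ∀ Z, Z ⊆ impCl (T \ unitaryBase F) Z := fun Z z hz A hA => hA.2 hz
  have key : ∀ X ∈ F, ∀ Y ∈ F,
      impCl (T \ unitaryBase F) (X ∪ Y) = clOp F (X ∪ Y) := by
    intro X hX Y hY
    apply Set.Subset.antisymm
    · intro z hz A hA
      exact hz A ⟨hle A hA.1, hA.2⟩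
    · have hA : ∀ z ∈ impCl (T \ unitaryBase F) (X ∪ Y),
          clOp F {z} ⊆ impCl (T \ unitaryBase F) (X ∪ Y) := by
        intro z hz
        refine (hz {w | w ∈ impCl (T \ unitaryBase F) (X ∪ Y) ∧
          clOp F {w} ⊆ impCl (T \ unitaryBase F) (X ∪ Y)} ⟨?_, ?_⟩).2
        · intro p hp hpA r hr
          have hrC := hclosed (X ∪ Y) p hp (fun y hy => (hpA hy).1) hr
          refine ⟨hrC, ?_⟩
          by_cases h : clOp F {r} = {r}
          · rw [h]
            exact Set.singleton_subset_iff.2 hrC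
          · have hrL : r ∈ impCl (T \ unitaryBase F) p.1 :=
              hclosed p.1 p hp (hsub _) hr
            have h2 := hideal p hp ({r}, clOp F {r}) ⟨r, h, rfl⟩
              (Set.singleton_subset_iff.2 hrL)
            intro y hy
            exact h2 hy _ ⟨hclosed _, fun y hy => (hpA hy).1⟩
        · intro w hw
          refine ⟨hsub _ hw, fun y hy => hsub _ ?_⟩
          rcases hw with hw | hw
          · exact Or.inl (hy X ⟨hX, Set.singleton_subset_iff.2 hw⟩)
          · exact Or.inr (hy Y ⟨hY, Set.singleton_subset_iff.2 hw⟩)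
      have hmem : impCl (T \ unitaryBase F) (X ∪ Y) ∈ impClosedSets T := by
        intro p hp hpC
        by_cases h : p ∈ unitaryBase F
        · obtain ⟨x, hx, rfl⟩ := h
          exact hA x (hpC rfl)
        · exact hclosed _ p ⟨hp, h⟩ hpC
      rw [← hF] at hmem
      intro z hz
      exact hz _ ⟨hmem, hsub _⟩
  refine ⟨⟨⟨?_, ?_⟩, hle, ?_⟩, key⟩
  · intro p _ _
    exact Set.subset_univ _
  · intro X hX Y hY p hp h
    exact Set.subset_inter (hX p hp (fun y hy => (h hy).1)) (hY p hp (fun y hy => (h hy).2))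
  · intro X hX Y hY
    exact (key X hX Y hY).symm
end

section
/- Let Σ be an implicational base of a closure system 𝔽 on a finite set S, with Σ = Σ_u ∪ Σ_nu as described. If Σ is ideal-closed and condition (*) holds, then every extension 𝔽'' of 𝔽 is contained in the family 𝔽_nu of Σ_nu-closed sets; that is, every member of any extension of 𝔽 is Σ_nu-closed. -/
/-!
Common framework: the finite ground set `S` is modelled as a finite type `α`;
subsets of `S` are terms of `Set α`, and the full set `S` is `Set.univ`.
-/

universe u

variable {α : Type u}

theorem aux_impCl_closed {α : Type u} (T : Set (Set α × Set α)) (X : Set α) :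
    ImpClosed T (impCl T X) := by
  intro p hp h y hy A hA
  exact hA.1 p hp (fun z hz => h hz A hA) hy

theorem aux_subset_impCl {α : Type u} (T : Set (Set α × Set α)) (X : Set α) :
    X ⊆ impCl T X := fun _ hx _ hA => hA.2 hx

theorem aux_impCl_subset {α : Type u} {T : Set (Set α × Set α)} {X A : Set α}
    (hA : ImpClosed T A) (h : X ⊆ A) : impCl T X ⊆ A := fun _ hx => hx A ⟨hA, h⟩

/-- In an extension, a member containing the closures of the points of a nonempty set
contains the closure of the set. -/
theorem aux_union {α : Type u} [Fintype α] (T : Set (Set α × Set α)) (F F'' : Set (Set α))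
    (hF : F = impClosedSets T) (hE : IsExtension F F'') (A : Set α) (hA : A ∈ F'')
    (L : Set α) (hL : L.Nonempty) (h : ∀ x ∈ L, clOp F {x} ⊆ A) : clOp F L ⊆ A := by
  have hmem : ∀ X, clOp F X ∈ F := by
    intro X
    subst hF
    exact aux_impCl_closed T X
  have key : ∀ M : Set α, M.Finite → (∀ x ∈ M, clOp F {x} ⊆ A) → M.Nonempty →
      clOp F M ⊆ A := by
    intro M hM
    induction M, hM using Set.Finite.induction_on with
    | empty => intro _ h; exact absurd h Set.not_nonempty_empty
    | @insert a s _ _ ih =>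
      intro hx _
      have ha : clOp F {a} ⊆ A := hx a (Set.mem_insert _ _)
      rcases s.eq_empty_or_nonempty with rfl | hs
      · simpa using ha
      have hsA : clOp F s ⊆ A := ih (fun x h => hx x (Set.mem_insert_of_mem _ h)) hs
      have e := hE.2.2 _ (hmem {a}) _ (hmem s)
      have h1 : clOp F'' (clOp F {a} ∪ clOp F s) ⊆ A :=
        fun y hy => hy A ⟨hA, Set.union_subset ha hsA⟩
      rw [← e] at h1
      refine subset_trans ?_ h1
      intro y hy B hB
      refine hy B ⟨hB.1, ?_⟩
      rintro z (rfl | hz)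
      · exact hB.2 (Or.inl (fun C hC => hC.2 rfl))
      · exact hB.2 (Or.inr (fun C hC => hC.2 hz))
  exact key L (Set.toFinite L) h hL

/-- if `Σ` is ideal-closed and condition (*) holds, then every extension
of `𝔽` is contained in `𝔽_nu`. -/
theorem extension_subset_nonunitary_closedSets {α : Type u} [Fintype α]
    (T : Set (Set α × Set α)) (F : Set (Set α))
    (hF : F = impClosedSets T)
    (hu : unitaryBase F ⊆ T)
    (hnu : ∀ p ∈ T \ unitaryBase F, 1 < p.1.ncard)
    (hideal : ∀ p ∈ T \ unitaryBase F,
      ImpClosed (unitaryBase F) (impCl (T \ unitaryBase F) p.1))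
    (hstar : ∀ p ∈ T \ unitaryBase F, ∀ x ∈ p.1,
      clOp F {x} \ {x} ⊆ impCl (T \ unitaryBase F) (p.1 \ {x})) :
    ∀ F'' : Set (Set α), IsExtension F F'' → F'' ⊆ impClosedSets (T \ unitaryBase F) := by
  intro F'' hE A hA
  set N := T \ unitaryBase F with hN
  have hFN : ∀ B ∈ F, ImpClosed N B := by
    intro B hB p hp
    rw [hF] at hB
    exact hB p hp.1
  have hsub : ∀ L, impCl N L ⊆ clOp F L := by
    intro L y hy B hB
    exact hy B ⟨hFN B hB.1, hB.2⟩
  have hpt : ∀ p ∈ N, ∀ x ∈ impCl N p.1, clOp F {x} ⊆ impCl N p.1 := by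
    intro p hp x hx
    by_cases h : clOp F {x} = {x}
    · rw [h]; simpa using hx
    · exact hideal p hp ({x}, clOp F {x}) ⟨x, h, rfl⟩ (by simpa using hx)
  have main : ∀ C : Set α, ∀ p ∈ N, impCl N p.1 = C → p.1 ⊆ A → C ⊆ A := by
    intro C
    induction C using WellFoundedLT.induction with
    | ind C IH =>
    let M : Set (Set α × Set α) := {q | q ∈ N ∧ impCl N q.1 ⊂ C}
    have hAM : ImpClosed M A := by
      intro q hq hqA
      exact subset_trans (aux_impCl_closed N q.1 q hq.1 (aux_subset_impCl N q.1))
        (IH _ hq.2 q hq.1 rfl hqA)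
    have inner : ∀ K : Set α, ∀ p ∈ N, impCl M p.1 = K → impCl N p.1 = C → p.1 ⊆ A →
        C ⊆ A := by
      intro K
      induction K using WellFoundedLT.induction with
      | ind K IH2 =>
      intro p hp hK hC hpA
      by_contra hcon
      have hne : p.1.Nonempty := by
        have := hnu p hp
        exact Set.nonempty_of_ncard_ne_zero (by omega)
      have hbad : ∃ x ∈ p.1, ¬ clOp F {x} ⊆ A := by
        by_contra hno
        push Not at hno
        apply hcon
        rw [← hC]
        exact (hsub p.1).trans (aux_union T F F'' hF hE A hA p.1 hne hno)
      obtain ⟨x, hx, hxA⟩ := hbad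
      have hLA : impCl M (p.1 \ {x}) ⊆ A :=
        aux_impCl_subset hAM (Set.diff_subset.trans hpA)
      have hxK : x ∉ impCl M (p.1 \ {x}) := by
        intro hxK
        have hcl : ImpClosed M (impCl M (p.1 \ {x}) \ {x}) := by
          intro q hq hqs
          have hqK := hqs.trans Set.diff_subset
          have hR := aux_impCl_closed M (p.1 \ {x}) q hq hqK
          intro y hy
          refine ⟨hR hy, ?_⟩
          rintro rfl
          apply hxA
          have hy2 : y ∈ impCl N q.1 :=
            aux_impCl_closed N q.1 q hq.1 (aux_subset_impCl N q.1) hy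
          exact (hpt q hq.1 y hy2).trans (IH _ hq.2 q hq.1 rfl (hqK.trans hLA))
        have := aux_impCl_subset hcl
          (show p.1 \ {x} ⊆ _ from fun y hy => ⟨aux_subset_impCl M _ hy, hy.2⟩) hxK
        exact this.2 rfl
      have hnc : ¬ ImpClosed N (impCl M (p.1 \ {x})) := by
        intro hc
        apply hxA
        intro y hy
        by_cases hyx : y = x
        · rw [hyx]; exact hpA hx
        · exact hLA (aux_impCl_subset hc (aux_subset_impCl M _) (hstar p hp x hx ⟨hy, hyx⟩))
      unfold ImpClosed at hnc
      push Not at hnc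
      obtain ⟨q, hq, hqK, hqR⟩ := hnc
      have hKp : impCl M (p.1 \ {x}) ⊆ impCl M p.1 :=
        aux_impCl_subset (aux_impCl_closed M p.1)
          (Set.diff_subset.trans (aux_subset_impCl M p.1))
      have hqC : impCl N q.1 ⊆ C := by
        rw [← hC]
        refine aux_impCl_subset (aux_impCl_closed N p.1) ((hqK.trans hKp).trans ?_)
        exact aux_impCl_subset (fun r hr => aux_impCl_closed N p.1 r hr.1)
          (aux_subset_impCl N p.1)
      have hqe : impCl N q.1 = C := by
        by_contra hne'
        exact hqR (aux_impCl_closed M _ q ⟨hq, lt_of_le_of_ne hqC hne'⟩ hqK)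
      have hlt : impCl M q.1 ⊂ K := by
        rw [← hK]
        have h1 : impCl M q.1 ⊆ impCl M (p.1 \ {x}) :=
          aux_impCl_subset (aux_impCl_closed M _) hqK
        refine ⟨h1.trans hKp, fun h => hxK (h1 (h (aux_subset_impCl M p.1 hx)))⟩
      exact hcon (IH2 _ hlt q hq rfl hqe (hqK.trans hLA))
    intro p hp hC hpA
    exact inner _ p hp rfl hC hpA
  intro p hp hpA
  exact (aux_impCl_closed N p.1 p hp (aux_subset_impCl N p.1)).trans (main _ p hp rfl hpA)
end

section
/- Let 𝔽 be a closure system on a finite set S with closure operator Φ, and let x ∈ U_Φ. Then 𝔽_x̄ = 𝔽 ∪ Δᶜ_x(𝔽) is a closure system on S. -/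
/-!
Common framework: the finite ground set `S` is modelled as a finite type `α`;
subsets of `S` are terms of `Set α`, and the full set `S` is `Set.univ`.
-/

universe u

variable {α : Type u}

/-- `𝔽_x̄ = 𝔽 ∪ Δᶜ_x(𝔽)` is a closure system. -/
theorem extStep_isClosureSystem {α : Type u} [Fintype α]
    (F : Set (Set α)) (hF : IsClosureSystem F)
    (x : α) (hx : clOp F {x} ≠ {x}) :
    IsClosureSystem (F ∪ deltaC F x) := by
  have key : ∀ X ∈ F, ∀ A ∈ deltaF F x, X ∩ (A ∪ {x}) ∈ F ∪ deltaC F x := by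
    intro X hX A hA
    by_cases h : x ∈ X
    · right
      refine ⟨X ∩ A, ⟨hF.2 X hX A hA.1, fun h' => hA.2 (h'.trans Set.inter_subset_right)⟩, ?_⟩
      ext y
      simp only [Set.mem_inter_iff, Set.mem_union, Set.mem_singleton_iff]
      grind
    · left
      have : X ∩ (A ∪ {x}) = X ∩ A := by
        ext y
        simp only [Set.mem_inter_iff, Set.mem_union, Set.mem_singleton_iff]
        grind
      rw [this]
      exact hF.2 X hX A hA.1
  refine ⟨Or.inl hF.1, ?_⟩
  rintro X (hX | ⟨A, hA, rfl⟩) Y (hY | ⟨B, hB, rfl⟩)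
  · exact Or.inl (hF.2 X hX Y hY)
  · exact key X hX B hB
  · rw [Set.inter_comm]
    exact key Y hY A hA
  · right
    refine ⟨A ∩ B, ⟨hF.2 A hA.1 B hB.1, fun h' => hA.2 (h'.trans Set.inter_subset_left)⟩, ?_⟩
    rw [Set.inter_union_distrib_right]
end

section
/- Let 𝔽 be a closure system on a finite set S with closure operator Φ, and let x ∈ U_Φ. Then 𝔽_x̄ = 𝔽 ∪ Δᶜ_x(𝔽) is an extension of 𝔽: 𝔽 ⊆ 𝔽_x̄ and for all F₁, F₂ ∈ 𝔽, the smallest member of 𝔽_x̄ containing F₁ ∪ F₂ equals Φ(F₁ ∪ F₂). -/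
/-!
Common framework: the finite ground set `S` is modelled as a finite type `α`;
subsets of `S` are terms of `Set α`, and the full set `S` is `Set.univ`.
-/

universe u

variable {α : Type u}

/-- `𝔽_x̄ = 𝔽 ∪ Δᶜ_x(𝔽)` is an extension of `𝔽`. -/
theorem extStep_isExtension {α : Type u} [Fintype α]
    (F : Set (Set α)) (hF : IsClosureSystem F)
    (x : α) (hx : clOp F {x} ≠ {x}) :
    IsExtension F (F ∪ deltaC F x) := by
  have key : ∀ Z ∈ F, x ∈ Z → clOp F {x} ⊆ Z := fun Z hZ hxZ =>
    Set.sInter_subset_of_mem ⟨hZ, by simpa using hxZ⟩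
  have mix : ∀ A ∈ deltaF F x, ∀ G ∈ F, (A ∪ {x}) ∩ G ∈ F ∪ deltaC F x := by
    rintro A ⟨hA, hnA⟩ G hG
    by_cases hxG : x ∈ G
    · right
      refine ⟨A ∩ G, ⟨hF.2 A hA G hG, fun h => hnA (h.trans Set.inter_subset_left)⟩, ?_⟩
      rw [Set.union_inter_distrib_right,
        Set.inter_eq_left.2 (Set.singleton_subset_iff.2 hxG)]
    · left
      have : (A ∪ {x}) ∩ G = A ∩ G := by
        rw [Set.union_inter_distrib_right, Set.singleton_inter_eq_empty.2 hxG, Set.union_empty]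
      rw [this]
      exact hF.2 A hA G hG
  refine ⟨⟨Or.inl hF.1, ?_⟩, Set.subset_union_left, ?_⟩
  · rintro X (hX | ⟨A, hA, rfl⟩) Y (hY | ⟨B, hB, rfl⟩)
    · exact Or.inl (hF.2 X hX Y hY)
    · rw [Set.inter_comm]
      exact mix B hB X hX
    · exact mix A hA Y hY
    · right
      refine ⟨A ∩ B, ⟨hF.2 A hA.1 B hB.1, fun h => hA.2 (h.trans Set.inter_subset_left)⟩, ?_⟩
      rw [Set.inter_union_distrib_right]
  · intro X hX Y hY
    apply Set.Subset.antisymm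
    · apply Set.subset_sInter
      rintro Z ⟨hZ | ⟨A, ⟨hA, hnA⟩, rfl⟩, hXY⟩
      · exact Set.sInter_subset_of_mem ⟨hZ, hXY⟩
      · have no : ∀ W ∈ F, W ⊆ A ∪ {x} → x ∉ W := by
          intro W hW hWA hxW
          apply hnA
          rintro y ⟨hy, hyx⟩
          rcases hWA (key W hW hxW hy) with h | h
          · exact h
          · exact absurd h hyx
        have sub : ∀ W ∈ F, W ⊆ A ∪ {x} → W ⊆ A := by
          intro W hW hWA y hy
          rcases hWA hy with h | h
          · exact h
          · exact absurd (Set.mem_singleton_iff.1 h ▸ hy) (no W hW hWA)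
        have h1 := sub X hX (Set.subset_union_left.trans hXY)
        have h2 := sub Y hY (Set.subset_union_right.trans hXY)
        have h3 : clOp F (X ∪ Y) ⊆ A :=
          Set.sInter_subset_of_mem ⟨hA, Set.union_subset h1 h2⟩
        exact h3.trans Set.subset_union_left
    · apply Set.subset_sInter
      rintro Z ⟨hZ, hXY⟩
      exact Set.sInter_subset_of_mem ⟨Or.inl hZ, hXY⟩
end

section
/- Let Σ be an implicational base of a closure system 𝔽 on a finite set S, with Σ = Σ_u ∪ Σ_nu as described, and suppose Σ is ideal-closed and condition (*) holds. Let x ∈ U_Φ and let Σ_x̄ = Σ \ {{x} → Φ({x})}. Then Σ_x̄ is an implicational base of 𝔽_x̄ = 𝔽 ∪ Δᶜ_x(𝔽); that is, a set F ⊆ S is Σ_x̄-closed if and only if F ∈ 𝔽 ∪ Δᶜ_x(𝔽). -/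
/-!
Common framework: the finite ground set `S` is modelled as a finite type `α`;
subsets of `S` are terms of `Set α`, and the full set `S` is `Set.univ`.
-/

universe u

variable {α : Type u}

/-- `Σ_x̄ = Σ \ {{x} → Φ({x})}` is an implicational base of
`𝔽_x̄ = 𝔽 ∪ Δᶜ_x(𝔽)`. -/
theorem base_of_extStep {α : Type u} [Fintype α]
    (T : Set (Set α × Set α)) (F : Set (Set α))
    (hF : F = impClosedSets T)
    (hu : unitaryBase F ⊆ T)
    (hnu : ∀ p ∈ T \ unitaryBase F, 1 < p.1.ncard)
    (hideal : ∀ p ∈ T \ unitaryBase F,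
      ImpClosed (unitaryBase F) (impCl (T \ unitaryBase F) p.1))
    (hstar : ∀ p ∈ T \ unitaryBase F, ∀ x ∈ p.1,
      clOp F {x} \ {x} ⊆ impCl (T \ unitaryBase F) (p.1 \ {x}))
    (x : α) (hx : clOp F {x} ≠ {x}) :
    ∀ A : Set α,
      ImpClosed (T \ {(({x} : Set α), clOp F {x})}) A ↔ A ∈ F ∪ deltaC F x := by
  have hmem : ∀ B, B ∈ F ↔ ImpClosed T B := fun B => by rw [hF]; rfl
  have hxu : (({x} : Set α), clOp F {x}) ∈ unitaryBase F := ⟨x, hx, rfl⟩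
  -- the nonunitary closure of a set inside a closed set stays inside
  have hsub : ∀ (L B : Set α), ImpClosed (T \ unitaryBase F) B → L ⊆ B →
      impCl (T \ unitaryBase F) L ⊆ B :=
    fun L B hB hL => Set.sInter_subset_of_mem ⟨hB, hL⟩
  intro A
  constructor
  · intro hA
    by_cases hAF : A ∈ F
    · exact Or.inl hAF
    have hxA : x ∈ A ∧ ¬ clOp F {x} ⊆ A := by
      by_contra hcon
      apply hAF
      rw [hmem]
      intro p hp hpA
      by_cases hpx : p = (({x} : Set α), clOp F {x})
      · subst hpx
        by_contra h
        exact hcon ⟨hpA rfl, h⟩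
      · exact hA p ⟨hp, hpx⟩ hpA
    obtain ⟨hxA, hnot⟩ := hxA
    have hAnu : ImpClosed (T \ unitaryBase F) A := fun p hp hpA =>
      hA p ⟨hp.1, fun h => hp.2 (by rw [Set.mem_singleton_iff.1 h]; exact hxu)⟩ hpA
    right
    refine ⟨A \ {x}, ⟨?_, ?_⟩, ?_⟩
    · rw [hmem]
      intro p hp hpA
      have hxp : x ∉ p.1 := fun h => (hpA h).2 rfl
      have hpL : p.1 ⊆ A := fun y hy => (hpA hy).1
      have hpR : p.2 ⊆ A := hA p ⟨hp, fun h => hxp (by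
        rw [Set.mem_singleton_iff.1 h]; exact rfl)⟩ hpL
      refine fun y hy => ⟨hpR hy, ?_⟩
      intro hyx
      have hyx' : y = x := hyx
      subst hyx'
      apply hnot
      by_cases hpu : p ∈ unitaryBase F
      · obtain ⟨z, hz, rfl⟩ := hpu
        refine Set.Subset.trans ?_ hpR
        intro w hw B hB
        exact hw B ⟨hB.1, Set.singleton_subset_iff.2 (hy B hB)⟩
      · have hcl : ({y} : Set α) ⊆ impCl (T \ unitaryBase F) p.1 := by
          rw [Set.singleton_subset_iff]
          intro B hB
          exact hB.1 p ⟨hp, hpu⟩ hB.2 hy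
        exact (hideal p ⟨hp, hpu⟩ _ hxu hcl).trans (hsub _ _ hAnu hpL)
    · intro h
      apply hnot
      intro y hy
      by_cases hyx : y = x
      · rw [hyx]; exact hxA
      · exact (h ⟨hy, hyx⟩).1
    · ext y
      by_cases hyx : y = x
      · simp [hyx, hxA]
      · simp [hyx]
  · rintro (hA | ⟨B, ⟨hB, hBx⟩, rfl⟩)
    · exact fun p hp => (hmem A).1 hA p hp.1
    · rw [hmem] at hB
      intro p hp hpB
      by_cases hxp : x ∈ p.1
      · exfalso
        by_cases hpu : p ∈ unitaryBase F
        · obtain ⟨z, hz, rfl⟩ := hpu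
          have : x = z := hxp
          subst this
          exact hp.2 rfl
        · apply hBx
          refine (hstar p ⟨hp.1, hpu⟩ x hxp).trans (hsub _ _ (fun q hq => hB q hq.1) ?_)
          intro y hy
          exact (hpB hy.1).resolve_right hy.2
      · refine (hB p hp.1 ?_).trans Set.subset_union_left
        intro y hy
        refine (hpB hy).resolve_right ?_
        intro h
        exact hxp ((Set.mem_singleton_iff.1 h) ▸ hy)
end

section
/- Let 𝔽 be a closure system on a finite set S with closure operator Φ, let x ∈ U_Φ, and let F be a meet-irreducible member of 𝔽. Then F is meet-irreducible in the closure system 𝔽_x̄ = 𝔽 ∪ Δᶜ_x(𝔽) if and only if F ∈ 𝕄¹ ∪ 𝕄² ∪ 𝕄³. -/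
/-!
Common framework: the finite ground set `S` is modelled as a finite type `α`;
subsets of `S` are terms of `Set α`, and the full set `S` is `Set.univ`.
-/

universe u

variable {α : Type u}

theorem coverSet_aux {α : Type u} [Fintype α]
    (F : Set (Set α)) (hF : IsClosureSystem F) (M : Set α) (hM : MeetIrred F M)
    (T : Set (Set α)) (hT : ∀ A ∈ T, A ∈ F ∧ M ⊂ A) : ⋂₀ T ∈ F ∧ M ⊂ ⋂₀ T := by
  have hfin : T.Finite := Set.toFinite T
  induction T, hfin using Set.Finite.induction_on with
  | empty =>
    rw [Set.sInter_empty]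
    exact ⟨hF.1, Set.ssubset_univ_iff.2 hM.2.1⟩
  | @insert a s ha hs ih =>
    rw [Set.sInter_insert]
    have h1 := hT a (Set.mem_insert _ _)
    have h2 := ih (fun A hA => hT A (Set.mem_insert_of_mem _ hA))
    refine ⟨hF.2 _ h1.1 _ h2.1,
      (Set.subset_inter h1.2.subset h2.2.subset).ssubset_of_ne ?_⟩
    intro he
    rcases hM.2.2 _ h1.1 _ h2.1 he with h | h
    · exact h1.2.ne h
    · exact h2.2.ne h

theorem clOp_subset_of_mem {α : Type u} (F : Set (Set α)) (x : α) (A : Set α)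
    (hA : A ∈ F) (hx : x ∈ A) : clOp F {x} ⊆ A :=
  Set.sInter_subset_of_mem ⟨hA, Set.singleton_subset_iff.2 hx⟩

theorem meetIrred_mixed {α : Type u} (F : Set (Set α)) (hF : IsClosureSystem F)
    (x : α) (M : Set α) (hM : MeetIrred F M)
    (h3 : ¬ clOp F {x} \ {x} ⊆ M → x ∈ coverSet F M)
    (A Y : Set α) (hA : A ∈ deltaF F x) (hY : Y ∈ F) (he : M = (A ∪ {x}) ∩ Y) : M = Y := by
  by_cases hxY : x ∈ Y
  · exfalso
    have hxM : x ∈ M := by rw [he]; exact ⟨Or.inr rfl, hxY⟩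
    have hs := clOp_subset_of_mem F x M hM.1 hxM
    apply hA.2
    rintro y ⟨hy, hyx⟩
    have := hs hy
    rw [he] at this
    exact this.1.resolve_right hyx
  · have he2 : M = A ∩ Y := by
      rw [he]
      ext y
      constructor
      · rintro ⟨h | h, hy⟩
        · exact ⟨h, hy⟩
        · exact absurd (h ▸ hy) hxY
      · rintro ⟨h, hy⟩
        exact ⟨Or.inl h, hy⟩
    rcases hM.2.2 _ hA.1 _ hY he2 with h | h
    · by_contra hne
      have hMY : M ⊂ Y := (he2 ▸ Set.inter_subset_right : M ⊆ Y).ssubset_of_ne hne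
      have := h3 (h ▸ hA.2)
      exact hxY (Set.mem_sInter.1 this Y ⟨hY, hMY⟩)
    · exact h

/-- a meet-irreducible of `𝔽` stays meet-irreducible in `𝔽_x̄`
iff it belongs to `𝕄¹ ∪ 𝕄² ∪ 𝕄³`. -/
theorem meetIrred_of_old_iff {α : Type u} [Fintype α]
    (F : Set (Set α)) (hF : IsClosureSystem F)
    (x : α) (hx : clOp F {x} ≠ {x})
    (M : Set α) (hM : MeetIrred F M) :
    MeetIrred (F ∪ deltaC F x) M ↔ M ∈ mm1 F x ∪ mm2 F x ∪ mm3 F x := by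
  constructor
  · intro h
    by_cases hs : clOp F {x} \ {x} ⊆ M
    · left
      by_cases hxM : x ∈ M
      · exact Or.inl ⟨hM, clOp_subset_of_mem F x M hM.1 hxM⟩
      · exact Or.inr ⟨hM, hs, hxM⟩
    · right
      refine ⟨hM, hs, ?_⟩
      by_contra hxc
      have hc : coverSet F M ∈ F ∧ M ⊂ coverSet F M :=
        coverSet_aux F hF M hM {A | A ∈ F ∧ M ⊂ A} (fun A hA => hA)
      have he : M = coverSet F M ∩ (M ∪ {x}) := by
        ext y
        constructor
        · intro hy
          exact ⟨hc.2.subset hy, Or.inl hy⟩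
        · rintro ⟨hy, h | h⟩
          · exact h
          · exact absurd (h ▸ hy) hxc
      rcases h.2.2 _ (Or.inl hc.1) _ (Or.inr ⟨M, ⟨hM.1, hs⟩, rfl⟩) he with h | h
      · exact hc.2.ne h
      · have hxM : x ∈ M := by rw [h]; exact Or.inr rfl
        exact hxc (hc.2.subset hxM)
  · intro h
    have h3 : ¬ clOp F {x} \ {x} ⊆ M → x ∈ coverSet F M := by
      intro hn
      rcases h with (h | h) | h
      · exact absurd (Set.diff_subset.trans h.2) hn
      · exact absurd h.2.1 hn
      · exact h.2.2
    refine ⟨Or.inl hM.1, hM.2.1, ?_⟩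
    rintro X (hX | ⟨A, hA, rfl⟩) Y (hY | ⟨B, hB, rfl⟩) he
    · exact hM.2.2 X hX Y hY he
    · exact Or.inl (meetIrred_mixed F hF x M hM h3 B X hB hX (he.trans (Set.inter_comm _ _)))
    · exact Or.inr (meetIrred_mixed F hF x M hM h3 A Y hA hY he)
    · exfalso
      have hxM : x ∈ M := by rw [he]; exact ⟨Or.inr rfl, Or.inr rfl⟩
      have hs := clOp_subset_of_mem F x M hM.1 hxM
      apply hA.2
      rintro y ⟨hy, hyx⟩
      have := hs hy
      rw [he] at this
      exact this.1.resolve_right hyx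
end

section
/- Let 𝔽 be a closure system on a finite set S with closure operator Φ, let x ∈ U_Φ, and let F ∈ Δᶜ_x(𝔽). Then F is meet-irreducible in the closure system 𝔽_x̄ = 𝔽 ∪ Δᶜ_x(𝔽) if and only if F \ {x} ∈ 𝕄³ ∪ 𝕄⁴ ∪ 𝕄⁵ ∪ 𝕄⁶. -/
/-!
Common framework: the finite ground set `S` is modelled as a finite type `α`;
subsets of `S` are terms of `Set α`, and the full set `S` is `Set.univ`.
-/

universe u

variable {α : Type u}

theorem clOp_sub_of_mem {F : Set (Set α)} {X B : Set α} (hB : B ∈ F) (h : X ⊆ B) :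
    clOp F X ⊆ B := Set.sInter_subset_of_mem ⟨hB, h⟩

theorem sub_clOp (F : Set (Set α)) (X : Set α) : X ⊆ clOp F X :=
  Set.subset_sInter fun _ h => h.2

theorem clOp_mem [Finite α] {F : Set (Set α)} (hF : IsClosureSystem F) (X : Set α) :
    clOp F X ∈ F := by
  have key : ∀ T : Set (Set α), T.Finite → T ⊆ F → ⋂₀ T ∈ F := by
    intro T hT
    induction T, hT using Set.Finite.induction_on with
    | empty => intro _; simpa using hF.1
    | insert _ _ ih =>
      intro h
      rw [Set.sInter_insert]
      exact hF.2 _ (h (Set.mem_insert _ _)) _ (ih fun y hy => h (Set.mem_insert_of_mem _ hy))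
  exact key _ (Set.toFinite _) fun _ h => h.1

theorem exists_coverIn [Finite α] {G : Set (Set α)} {A Y : Set α} (hY : Y ∈ G) (h : A ⊂ Y) :
    ∃ B, CoverIn G A B ∧ B ⊆ Y := by
  have hfin : {C | C ∈ G ∧ A ⊂ C ∧ C ⊆ Y}.Finite := Set.toFinite _
  obtain ⟨B, hB⟩ := hfin.exists_minimal ⟨Y, hY, h, subset_rfl⟩
  refine ⟨B, ⟨hB.1.1, hB.1.2.1, ?_⟩, hB.1.2.2⟩
  rintro C hC ⟨h1, h2⟩
  exact h2.2 (hB.2 ⟨hC, h1, h2.1.trans hB.1.2.2⟩ h2.1)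

theorem mm345_iff (F : Set (Set α)) (x : α) (M : Set α) :
    M ∈ mm3 F x ∪ mm4 F x ∪ mm5 F x ∪ mm6 F x ↔
      (MeetIrred F M ∧ ¬ clOp F {x} \ {x} ⊆ M) ∨ M ∈ mm6 F x := by
  simp only [Set.mem_union, mm3, mm4, mm5, Set.mem_ofPred_eq]
  tauto

theorem not_mem_of_delta {F : Set (Set α)} {x : α} {B : Set α} (h : B ∈ deltaF F x) :
    x ∉ B := fun hx => h.2 (Set.sdiff_subset.trans
      (clOp_sub_of_mem h.1 (Set.singleton_subset_iff.2 hx)))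

theorem not_mem_F {F : Set (Set α)} {x : α} {B : Set α} (h : B ∈ deltaF F x) :
    B ∪ {x} ∉ F := fun hB => h.2 (fun y hy => by
      have := clOp_sub_of_mem hB (X := {x}) (by simp) hy.1
      rcases this with h | h
      · exact h
      · exact absurd h hy.2)

theorem delta_mono {F : Set (Set α)} {x : α} {B C : Set α} (h : B ∈ deltaF F x)
    (hC : C ∈ F) (hCB : C ⊆ B) : C ∈ deltaF F x :=
  ⟨hC, fun hs => h.2 (hs.trans hCB)⟩

/-- Decomposition principle for members of `Δᶜ_x(F)`. -/
theorem irred_new_iff {F : Set (Set α)} (hF : IsClosureSystem F) {x : α}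
    {B : Set α} (hB : B ∈ deltaF F x) :
    MeetIrred (F ∪ deltaC F x) (B ∪ {x}) ↔
      ∀ Y ∈ deltaF F x, ∀ X, (X ∈ deltaF F x ∧ B ≠ X ∨ X ∈ F ∧ x ∈ X) → B = X ∩ Y → B = Y := by
  have hxB := not_mem_of_delta hB
  have hinj : ∀ Y ∈ deltaF F x, B ∪ {x} = Y ∪ {x} → B = Y := by
    intro Y hY h
    have hxY := not_mem_of_delta hY
    ext y
    have := Set.ext_iff.1 h y
    by_cases hy : y = x
    · subst hy; tauto
    · simpa [hy] using this
  constructor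
  · rintro ⟨-, -, h⟩ Y hY X hX rfl
    rcases hX with ⟨hX, hne⟩ | ⟨hX, hxX⟩
    · rcases h (X ∪ {x}) (Or.inr ⟨X, hX, rfl⟩) (Y ∪ {x}) (Or.inr ⟨Y, hY, rfl⟩)
        (by rw [Set.inter_union_distrib_right]) with h | h
      · exact absurd (hinj _ hX h) hne
      · exact hinj _ hY h
    · rcases h X (Or.inl hX) (Y ∪ {x}) (Or.inr ⟨Y, hY, rfl⟩)
        (by ext y; by_cases hy : y = x
            · subst hy; simp [hxX]
            · simp [hy]) with h | h
      · exact absurd (h.symm ▸ hX : X ∩ Y ∪ {x} ∈ F) (not_mem_F hB)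
      · exact hinj _ hY h
  · intro h
    have mixed : ∀ X ∈ F, ∀ Y ∈ deltaF F x, B ∪ {x} = X ∩ (Y ∪ {x}) → B = Y := by
      intro X hX Y hY e
      have hxX : x ∈ X := (e ▸ (Or.inr rfl : x ∈ B ∪ {x}) : x ∈ X ∩ (Y ∪ {x})).1
      refine h Y hY X (Or.inr ⟨hX, hxX⟩) ?_
      have hxY := not_mem_of_delta hY
      ext y
      have := Set.ext_iff.1 e y
      by_cases hy : y = x
      · subst hy; simp [hxB, hxY]
      · simpa [hy] using this
    refine ⟨Or.inr ⟨B, hB, rfl⟩, fun e => not_mem_F hB (e ▸ hF.1), ?_⟩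
    rintro X (hX | ⟨X, hX, rfl⟩) Y (hY | ⟨Y, hY, rfl⟩) e
    · exact absurd (e ▸ hF.2 _ hX _ hY) (not_mem_F hB)
    · right; rw [← mixed X hX Y hY e]
    · left; rw [← mixed Y hY X hX (by rw [e, Set.inter_comm])]
    · by_cases hne : B = X
      · left; rw [hne]
      · right
        rw [← h Y hY X (Or.inl ⟨hX, hne⟩) ?_]
        rw [← Set.inter_union_distrib_right] at e
        exact hinj _ (delta_mono hX (hF.2 _ hX.1 _ hY.1) Set.inter_subset_left) e

/-- a member of `Δᶜ_x(𝔽)` is meet-irreducible in `𝔽_x̄`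
iff removing `x` lands in `𝕄³ ∪ 𝕄⁴ ∪ 𝕄⁵ ∪ 𝕄⁶`. -/
theorem meetIrred_of_new_iff {α : Type u} [Fintype α]
    (F : Set (Set α)) (hF : IsClosureSystem F)
    (x : α) (hx : clOp F {x} ≠ {x})
    (A : Set α) (hA : A ∈ deltaC F x) :
    MeetIrred (F ∪ deltaC F x) A ↔
      A \ {x} ∈ mm3 F x ∪ mm4 F x ∪ mm5 F x ∪ mm6 F x := by
  obtain ⟨B, hB, rfl⟩ := hA
  have hxB := not_mem_of_delta hB
  have e : (B ∪ {x}) \ {x} = B := by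
    ext y
    by_cases hy : y = x
    · subst hy; simp [hxB]
    · simp [hy]
  rw [e, mm345_iff, irred_new_iff hF hB]
  constructor
  · intro h
    by_cases hm : MeetIrred F B
    · exact Or.inl ⟨hm, hB.2⟩
    refine Or.inr ⟨hB, hm, ?_⟩
    -- existence of a cover
    have hex : ∃ Y ∈ deltaF F x, B ⊂ Y := by
      by_contra hno
      push Not at hno
      refine hm ⟨hB.1, fun e => hB.2 (e ▸ Set.subset_univ _), fun X hX Y hY e => ?_⟩
      by_contra hne
      push Not at hne
      have hBX : B ⊂ X := (e ▸ Set.inter_subset_left : B ⊆ X).ssubset_of_ne hne.1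
      have hBY : B ⊂ Y := (e ▸ Set.inter_subset_right : B ⊆ Y).ssubset_of_ne hne.2
      have h1 : clOp F {x} \ {x} ⊆ X := by
        by_contra h'; exact hno X ⟨hX, h'⟩ hBX
      have h2 : clOp F {x} \ {x} ⊆ Y := by
        by_contra h'; exact hno Y ⟨hY, h'⟩ hBY
      exact hB.2 (e ▸ Set.subset_inter h1 h2)
    obtain ⟨Y, hY, hBY⟩ := hex
    obtain ⟨C, hC, -⟩ := exists_coverIn hY hBY
    -- meeting a cover with a member of `F` above `B` not above the cover gives `B`
    have meet : ∀ D, CoverIn (deltaF F x) B D → ∀ X ∈ F, B ⊆ X → ¬ D ⊆ X → B = X ∩ D := by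
      intro D hD X hX hBX hDX
      by_contra hne
      refine hD.2.2 (X ∩ D) (delta_mono hD.1 (hF.2 _ hX _ hD.1.1) Set.inter_subset_right)
        ⟨(Set.subset_inter hBX hD.2.1.1).ssubset_of_ne hne, Set.inter_subset_right, ?_⟩
      exact fun hs => hDX (hs.trans Set.inter_subset_left)
    refine ⟨C, hC, ?_, ?_⟩
    · intro D hD
      by_contra hne
      have hCD : ¬ C ⊆ D := fun hs =>
        hD.2.2 C hC.1 ⟨hC.2.1, hs.ssubset_of_ne (Ne.symm hne)⟩
      exact hC.2.1.ne (h C hC.1 D (Or.inl ⟨hD.1, hD.2.1.ne⟩)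
        (meet C hC D hD.1.1 hD.2.1.1 hCD))
    · have hsub := sub_clOp F (B ∪ {x})
      have hxm : x ∈ clOp F (B ∪ {x}) := hsub (Or.inr rfl)
      have hCs : C ⊆ clOp F (B ∪ {x}) := by
        by_contra hn
        exact hC.2.1.ne (h C hC.1 _ (Or.inr ⟨clOp_mem hF _, hxm⟩)
          (meet C hC _ (clOp_mem hF _) (Set.subset_union_left.trans hsub) hn))
      apply Set.Subset.antisymm
      · exact clOp_sub_of_mem (clOp_mem hF _)
          ((Set.union_subset_union_left _ hC.2.1.1).trans (sub_clOp F _))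
      · exact clOp_sub_of_mem (clOp_mem hF _)
          (Set.union_subset hCs (Set.singleton_subset_iff.2 hxm))
  · rintro (⟨hm, -⟩ | ⟨-, -, C, hC, huniq, hcl⟩) Y hY X hX e
    · have hXF : X ∈ F := hX.elim (fun h => h.1.1) fun h => h.1
      have hne : B ≠ X := hX.elim (fun h => h.2) fun h e => hxB (e ▸ h.2)
      exact (hm.2.2 X hXF Y hY.1 e).resolve_left hne
    · have above : ∀ D ∈ deltaF F x, B ⊂ D → C ⊆ D := by
        intro D hD hBD
        obtain ⟨E, hE, hED⟩ := exists_coverIn hD hBD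
        exact huniq E hE ▸ hED
      have hBX : B ⊆ X := e ▸ Set.inter_subset_left
      have hBY : B ⊆ Y := e ▸ Set.inter_subset_right
      by_contra hne
      have hCY := above Y hY (hBY.ssubset_of_ne hne)
      have hCX : C ⊆ X := by
        rcases hX with ⟨hX, hne'⟩ | ⟨hX, hxX⟩
        · exact above X hX (hBX.ssubset_of_ne hne')
        · have h1 : C ⊆ clOp F (B ∪ {x}) := by
            rw [hcl]; exact Set.subset_union_left.trans (sub_clOp F _)
          exact h1.trans (clOp_sub_of_mem hX
            (Set.union_subset hBX (Set.singleton_subset_iff.2 hxX)))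
      exact hC.2.1.2 (e ▸ Set.subset_inter hCX hCY)
end

section
/- Let 𝔽 be a closure system on a finite set S with closure operator Φ and let x ∈ U_Φ. For every F ∈ 𝕄⁶ there exist M' ∈ 𝕄³ ∪ 𝕄⁴ and M'' ∈ 𝕄² such that F = M' ∩ M''. -/
/-!
Common framework: the finite ground set `S` is modelled as a finite type `α`;
subsets of `S` are terms of `Set α`, and the full set `S` is `Set.univ`.
-/

universe u

variable {α : Type u}

theorem mm6_key {α : Type u} [Fintype α] (F : Set (Set α)) (x : α) (A B : Set α)
    (huniq : ∀ C, CoverIn (deltaF F x) A C → C = B)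
    (hcl : clOp F (A ∪ {x}) = clOp F (B ∪ {x}))
    (G : Set α) (hG : G ∈ F) (hAG : A ⊂ G) (hB : ¬ B ⊆ G) :
    clOp F {x} \ {x} ⊆ G ∧ x ∉ G := by
  constructor
  · by_contra hP
    apply hB
    have hfin : {C | C ∈ deltaF F x ∧ A ⊂ C ∧ C ⊆ G}.Finite := Set.toFinite _
    obtain ⟨C, hC⟩ := hfin.exists_minimal ⟨G, ⟨hG, hP⟩, hAG, subset_rfl⟩
    have hcov : CoverIn (deltaF F x) A C := by
      refine ⟨hC.1.1, hC.1.2.1, ?_⟩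
      rintro D hD ⟨h1, h2⟩
      exact h2.2 (hC.2 ⟨hD, h1, h2.1.trans hC.1.2.2⟩ h2.1)
    rw [← huniq C hcov]
    exact hC.1.2.2
  · intro hxG
    apply hB
    intro b hb
    have h1 : b ∈ clOp F (B ∪ {x}) := fun D hD => hD.2 (Or.inl hb)
    rw [← hcl] at h1
    exact h1 G ⟨hG, Set.union_subset hAG.1 (Set.singleton_subset_iff.2 hxG)⟩

/-- every member of `𝕄⁶` is the intersection of a member of
`𝕄³ ∪ 𝕄⁴` and a member of `𝕄²`. -/
theorem mm6_eq_inter {α : Type u} [Fintype α]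
    (F : Set (Set α)) (hF : IsClosureSystem F)
    (x : α) (hx : clOp F {x} ≠ {x}) :
    ∀ A ∈ mm6 F x, ∃ M' ∈ mm3 F x ∪ mm4 F x, ∃ M'' ∈ mm2 F x, A = M' ∩ M'' := by
  rintro A ⟨⟨hA, hAP⟩, hirr, B, ⟨⟨hBF, hBP⟩, hAB, hnob⟩, huniq, hcl⟩
  have key := mm6_key F x A B huniq hcl
  have hG : ∃ G ∈ F, A ⊂ G ∧ ¬ B ⊆ G := by
    by_contra hcon
    push Not at hcon
    apply hirr
    refine ⟨hA, fun h => hAP (h ▸ Set.subset_univ _), fun X hX Y hY hXY => ?_⟩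
    by_contra hne
    push Not at hne
    have h1 := hcon X hX ((hXY.subset.trans Set.inter_subset_left).ssubset_of_ne hne.1)
    have h2 := hcon Y hY ((hXY.subset.trans Set.inter_subset_right).ssubset_of_ne hne.2)
    exact hAB.2 (hXY ▸ Set.subset_inter h1 h2)
  obtain ⟨G, hGF, hAG, hBG⟩ := hG
  have hfin : {C | C ∈ F ∧ A ⊂ C ∧ ¬ B ⊆ C}.Finite := Set.toFinite _
  obtain ⟨M, hM⟩ := hfin.exists_maximal ⟨G, hGF, hAG, hBG⟩
  obtain ⟨⟨hMF, hAM, hBM⟩, hMmax⟩ := hM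
  obtain ⟨hPM, hxM⟩ := key M hMF hAM hBM
  have hM2 : M ∈ mm2 F x := by
    refine ⟨⟨hMF, fun h => hBM (h ▸ Set.subset_univ _), fun X hX Y hY hXY => ?_⟩, hPM, hxM⟩
    by_contra hne
    push Not at hne
    have aux : ∀ Z ∈ F, M ⊂ Z → B ⊆ Z := by
      intro Z hZ hMZ
      by_contra hBZ
      exact hMZ.2 (hMmax ⟨hZ, hAM.trans hMZ, hBZ⟩ hMZ.1)
    have h1 := aux X hX ((hXY.subset.trans Set.inter_subset_left).ssubset_of_ne hne.1)
    have h2 := aux Y hY ((hXY.subset.trans Set.inter_subset_right).ssubset_of_ne hne.2)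
    exact hBM (hXY ▸ Set.subset_inter h1 h2)
  have hfin2 : {C | C ∈ F ∧ C ∩ M = A}.Finite := Set.toFinite _
  obtain ⟨N, hN⟩ := hfin2.exists_maximal ⟨A, hA, Set.inter_eq_left.2 hAM.1⟩
  obtain ⟨⟨hNF, hNM⟩, hNmax⟩ := hN
  have hPN : ¬ clOp F {x} \ {x} ⊆ N := fun h => hAP (hNM ▸ Set.subset_inter h hPM)
  have hAN : A ⊆ N := hNM ▸ Set.inter_subset_left
  have up : ∀ Z ∈ F, N ⊂ Z → clOp F {x} \ {x} ⊆ Z := by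
    intro Z hZ hNZ
    have h1 : A ⊂ Z ∩ M := by
      refine (Set.subset_inter (hAN.trans hNZ.1) hAM.1).ssubset_of_ne fun h => ?_
      exact hNZ.2 (hNmax ⟨hZ, h.symm⟩ hNZ.1)
    exact (key (Z ∩ M) (hF.2 Z hZ M hMF) h1
      (fun h => hBM (h.trans Set.inter_subset_right))).1.trans Set.inter_subset_left
  have hNirr : MeetIrred F N := by
    refine ⟨hNF, fun h => hPN (h ▸ Set.subset_univ _), fun X hX Y hY hXY => ?_⟩
    by_contra hne
    push Not at hne
    have h1 := up X hX ((hXY.subset.trans Set.inter_subset_left).ssubset_of_ne hne.1)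
    have h2 := up Y hY ((hXY.subset.trans Set.inter_subset_right).ssubset_of_ne hne.2)
    exact hPN (hXY ▸ Set.subset_inter h1 h2)
  refine ⟨N, ?_, M, hM2, hNM.symm⟩
  by_cases hxc : x ∈ coverSet F N
  · exact Or.inl ⟨hNirr, hPN, hxc⟩
  · exact Or.inr ⟨hNirr, hPN, hxc, Set.subset_sInter fun Z hZ => up Z hZ.1 hZ.2⟩
end

section
/- Let 𝔽 be a closure system on a finite set S with closure operator Φ and let x ∈ U_Φ. Then the set of meet-irreducible members of the closure system 𝔽_x̄ = 𝔽 ∪ Δᶜ_x(𝔽) equals 𝕄¹ ∪ 𝕄² ∪ 𝕄³ ∪ {M ∪ {x} : M ∈ 𝕄³ ∪ 𝕄⁴ ∪ 𝕄⁵ ∪ 𝕄⁶}. -/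
/-!
Common framework: the finite ground set `S` is modelled as a finite type `α`;
subsets of `S` are terms of `Set α`, and the full set `S` is `Set.univ`.
-/

universe u

variable {α : Type u}

theorem subset_clOp_aux {α : Type u} (F : Set (Set α)) (X : Set α) : X ⊆ clOp F X :=
  fun _ ha _ hA => hA.2 ha

theorem clOp_subset_aux {α : Type u} {F : Set (Set α)} {X A : Set α} (hA : A ∈ F) (h : X ⊆ A) :
    clOp F X ⊆ A := fun _ ha => ha A ⟨hA, h⟩

theorem sInter_mem_aux {α : Type u} [Fintype α] {F : Set (Set α)} (hF : IsClosureSystem F)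
    (T : Set (Set α)) (hT : T ⊆ F) : ⋂₀ T ∈ F := by
  have hfin : T.Finite := Set.toFinite T
  induction T, hfin using Set.Finite.induction_on with
  | empty => simpa using hF.1
  | insert _ _ ih =>
    rw [Set.sInter_insert]
    exact hF.2 _ (hT (Set.mem_insert _ _)) _ (ih (fun a ha => hT (Set.mem_insert_of_mem _ ha)))

theorem clOp_mem_aux {α : Type u} [Fintype α] {F : Set (Set α)} (hF : IsClosureSystem F)
    (X : Set α) : clOp F X ∈ F := sInter_mem_aux hF _ (fun _ h => h.1)

theorem exists_cover_aux {α : Type u} [Fintype α] (G : Set (Set α)) (A D : Set α)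
    (hD : D ∈ G) (h : A ⊂ D) : ∃ B, CoverIn G A B ∧ B ⊆ D := by
  have hfin : ({B | B ∈ G ∧ A ⊂ B ∧ B ⊆ D} : Set (Set α)).Finite := Set.toFinite _
  obtain ⟨B, hB⟩ := hfin.exists_minimal ⟨D, hD, h, subset_rfl⟩
  refine ⟨B, ⟨hB.1.1, hB.1.2.1, ?_⟩, hB.1.2.2⟩
  rintro C hC ⟨h1, h2⟩
  exact h2.2 (hB.2 ⟨hC, h1, h2.1.trans hB.1.2.2⟩ h2.1)

/-- The meet-irreducibles of `𝔽_x̄` are exactly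
`𝕄¹ ∪ 𝕄² ∪ 𝕄³ ∪ {M ∪ {x} : M ∈ 𝕄³ ∪ 𝕄⁴ ∪ 𝕄⁵ ∪ 𝕄⁶}`. -/
theorem meetIrred_extStep_eq {α : Type u} [Fintype α]
    (F : Set (Set α)) (hF : IsClosureSystem F)
    (x : α) (hx : clOp F {x} ≠ {x}) :
    {M : Set α | MeetIrred (F ∪ deltaC F x) M} =
      mm1 F x ∪ mm2 F x ∪ mm3 F x ∪
        {B | ∃ M ∈ mm3 F x ∪ mm4 F x ∪ mm5 F x ∪ mm6 F x, B = M ∪ {x}} := by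
  have hxC : x ∈ clOp F {x} := subset_clOp_aux F {x} rfl
  have hup : ∀ A ∈ F, x ∈ A → clOp F {x} ⊆ A := fun A hA h =>
    clOp_subset_aux hA (by simpa using h)
  have hdx : ∀ A ∈ deltaF F x, x ∉ A := fun A hA h =>
    hA.2 (Set.diff_subset.trans (hup A hA.1 h))
  have hdP : ∀ A : Set α, ¬ clOp F {x} \ {x} ⊆ A → ¬ clOp F {x} \ {x} ⊆ A ∪ {x} := by
    intro A h h2
    exact h fun a ha => (h2 ha).resolve_right ha.2
  have hdF : ∀ A : Set α, ¬ clOp F {x} \ {x} ⊆ A → A ∪ {x} ∉ F := fun A h h2 =>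
    hdP A h (Set.diff_subset.trans (hup _ h2 (Or.inr rfl)))
  -- members of the extended family that contain `Φ_*(x)` are members of `F`
  have hGP : ∀ A ∈ F ∪ deltaC F x, clOp F {x} \ {x} ⊆ A → A ∈ F := by
    rintro A (hA | ⟨B, hB, rfl⟩) h
    · exact hA
    · exact absurd h (hdP B hB.2)
  -- duplicating a meet-irreducible
  have hdup : ∀ M, MeetIrred F M → ¬ clOp F {x} \ {x} ⊆ M →
      MeetIrred (F ∪ deltaC F x) (M ∪ {x}) := by
    intro M hM hP
    have hMd : M ∈ deltaF F x := ⟨hM.1, hP⟩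
    have hxM := hdx M hMd
    refine ⟨Or.inr ⟨M, hMd, rfl⟩, fun h => hdP M hP (by rw [h]; exact Set.subset_univ _), ?_⟩
    -- every member above `M ∪ {x}` comes from a member of `F`
    have key : ∀ X ∈ F ∪ deltaC F x, M ∪ {x} ⊆ X → ∃ X' ∈ F, M ⊆ X' ∧ X = X' ∪ {x} := by
      rintro X (hX | ⟨B, hB, rfl⟩) h
      · exact ⟨X, hX, Set.subset_union_left.trans h, by
          rw [Set.union_eq_self_of_subset_right (Set.subset_union_right.trans h)]⟩
      · exact ⟨B, hB.1, fun a ha => (h (Or.inl ha)).resolve_right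
          (fun h' => hxM (by rw [Set.mem_singleton_iff] at h'; exact h' ▸ ha)), rfl⟩
    intro X hX Y hY hXY
    obtain ⟨X', hX', hMX, rfl⟩ := key X hX (by rw [hXY]; exact Set.inter_subset_left)
    obtain ⟨Y', hY', hMY, rfl⟩ := key Y hY (by rw [hXY]; exact Set.inter_subset_right)
    rw [← Set.inter_union_distrib_right] at hXY
    by_cases hx' : x ∈ X' ∩ Y'
    · exfalso
      apply hdF M hP
      rw [hXY, Set.union_eq_self_of_subset_right (by simpa using hx')]
      exact hF.2 _ hX' _ hY'
    · have : M = X' ∩ Y' := by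
        apply Set.Subset.antisymm (Set.subset_inter hMX hMY)
        intro a ha
        have : a ∈ M ∪ {x} := by rw [hXY]; exact Or.inl ha
        exact this.resolve_right fun h' => hx' (by rw [Set.mem_singleton_iff] at h'; exact h' ▸ ha)
      rcases hM.2.2 _ hX' _ hY' this with h | h
      · left; rw [← h]
      · right; rw [← h]
  have hFirr : ∀ M, MeetIrred (F ∪ deltaC F x) M → M ∈ F → MeetIrred F M := fun M h hM =>
    ⟨hM, h.2.1, fun X hX Y hY => h.2.2 X (Or.inl hX) Y (Or.inl hY)⟩
  have hirrP : ∀ M, MeetIrred F M → clOp F {x} \ {x} ⊆ M → MeetIrred (F ∪ deltaC F x) M := by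
    intro M h hP
    refine ⟨Or.inl h.1, h.2.1, fun X hX Y hY e => h.2.2 X (hGP X hX ?_) Y (hGP Y hY ?_) e⟩
    · rw [e] at hP; exact hP.trans Set.inter_subset_left
    · rw [e] at hP; exact hP.trans Set.inter_subset_right
  ext M
  constructor
  · intro hM
    change MeetIrred _ M at hM
    rcases hM.1 with hMF | ⟨A, hA, rfl⟩
    · left
      have hMi := hFirr M hM hMF
      by_cases hP : clOp F {x} \ {x} ⊆ M
      · left
        by_cases hxM : x ∈ M
        · exact Or.inl ⟨hMi, hup M hMF hxM⟩
        · exact Or.inr ⟨hMi, hP, hxM⟩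
      · right
        refine ⟨hMi, hP, ?_⟩
        rintro A ⟨hA, hMA⟩
        by_contra hxA
        have hxM : x ∉ M := fun h => hxA (hMA.1 h)
        have e : M = (M ∪ {x}) ∩ A := by
          ext a
          constructor
          · exact fun h => ⟨Or.inl h, hMA.1 h⟩
          · rintro ⟨h | h, h2⟩
            · exact h
            · rw [Set.mem_singleton_iff] at h; exact absurd (h ▸ h2) hxA
        rcases hM.2.2 _ (Or.inr ⟨M, ⟨hMF, hP⟩, rfl⟩) A (Or.inl hA) e with h | h
        · exact hxM (by rw [h]; exact Or.inr rfl)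
        · exact hMA.ne h
    · right
      refine ⟨A, ?_, rfl⟩
      by_cases hAi : MeetIrred F A
      · left
        by_cases h1 : x ∈ coverSet F A
        · exact Or.inl (Or.inl ⟨hAi, hA.2, h1⟩)
        · by_cases h2 : clOp F {x} \ {x} ⊆ coverSet F A
          · exact Or.inl (Or.inr ⟨hAi, hA.2, h1, h2⟩)
          · exact Or.inr ⟨hAi, hA.2, h1, h2⟩
      · right
        have hxA := hdx A hA
        refine ⟨hA, hAi, ?_⟩
        have hD : ∃ D ∈ deltaF F x, A ⊂ D := by
          by_contra hno
          push Not at hno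
          apply hAi
          refine ⟨hA.1, fun h => hA.2 (by rw [h]; exact Set.subset_univ _), ?_⟩
          intro X hX Y hY e
          by_contra hne
          push Not at hne
          have hAX : A ⊂ X := lt_of_le_of_ne (e.le.trans Set.inter_subset_left) hne.1
          have hAY : A ⊂ Y := lt_of_le_of_ne (e.le.trans Set.inter_subset_right) hne.2
          have h1 : clOp F {x} \ {x} ⊆ X := by
            by_contra h; exact hno X ⟨hX, h⟩ hAX
          have h2 : clOp F {x} \ {x} ⊆ Y := by
            by_contra h; exact hno Y ⟨hY, h⟩ hAY
          exact hA.2 (by rw [e]; exact Set.subset_inter h1 h2)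
        obtain ⟨D, hD, hAD⟩ := hD
        obtain ⟨B, hB, -⟩ := exists_cover_aux _ A D hD hAD
        have hne : ∀ C ∈ deltaF F x, A ⊂ C → A ∪ {x} ≠ C ∪ {x} := by
          intro C hC hAC h
          apply hAC.2
          intro a ha
          have : a ∈ A ∪ {x} := by rw [h]; exact Or.inl ha
          exact this.resolve_right fun h' => hdx C hC
            (by rw [Set.mem_singleton_iff] at h'; exact h' ▸ ha)
        have hcov : ∀ E ∈ F, A ⊂ E → E ⊆ B → E = B := by
          intro E hE h1 h2
          by_contra h3
          exact hB.2.2 E ⟨hE, fun h => hB.1.2 (h.trans h2)⟩ ⟨h1, lt_of_le_of_ne h2 h3⟩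
        refine ⟨B, hB, ?_, ?_⟩
        · intro C hC
          by_contra hCB
          have e : A = C ∩ B := by
            by_contra hne'
            have h1 : A ⊂ C ∩ B := lt_of_le_of_ne (Set.subset_inter hC.2.1.1 hB.2.1.1) hne'
            have h2 := hcov _ (hF.2 _ hC.1.1 _ hB.1.1) h1 Set.inter_subset_right
            have h3 : B ⊆ C := by rw [← h2]; exact Set.inter_subset_left
            exact hC.2.2 B hB.1 ⟨hB.2.1, lt_of_le_of_ne h3 (Ne.symm hCB)⟩
          rcases hM.2.2 (C ∪ {x}) (Or.inr ⟨C, hC.1, rfl⟩) (B ∪ {x}) (Or.inr ⟨B, hB.1, rfl⟩)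
            (by rw [← Set.inter_union_distrib_right, ← e]) with h | h
          · exact hne C hC.1 hC.2.1 h
          · exact hne B hB.1 hB.2.1 h
        · have hcl := clOp_mem_aux hF (A ∪ {x})
          have hsub := subset_clOp_aux F (A ∪ {x})
          have hBs : B ⊆ clOp F (A ∪ {x}) := by
            have hne' : A ≠ clOp F (A ∪ {x}) ∩ B := by
              intro e
              rcases hM.2.2 (clOp F (A ∪ {x})) (Or.inl hcl) (B ∪ {x}) (Or.inr ⟨B, hB.1, rfl⟩)
                (by
                  rw [Set.inter_union_distrib_left, ← e, Set.inter_eq_self_of_subset_right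
                    (Set.subset_union_right.trans hsub)]) with h | h
              · exact hdF A hA.2 (by rw [h]; exact hcl)
              · exact hne B hB.1 hB.2.1 h
            have h1 : A ⊂ clOp F (A ∪ {x}) ∩ B := lt_of_le_of_ne
              (Set.subset_inter (Set.subset_union_left.trans hsub) hB.2.1.1) hne'
            rw [← hcov _ (hF.2 _ hcl _ hB.1.1) h1 Set.inter_subset_right]
            exact Set.inter_subset_left
          apply Set.Subset.antisymm
          · exact clOp_subset_aux (clOp_mem_aux hF _)
              ((Set.union_subset_union_left _ hB.2.1.1).trans (subset_clOp_aux F _))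
          · exact clOp_subset_aux hcl
              (Set.union_subset hBs (Set.subset_union_right.trans hsub))
  · change _ → MeetIrred _ M
    rintro (((h | h) | h) | ⟨A, ((h | h) | h) | h, rfl⟩)
    · exact hirrP M h.1 (Set.diff_subset.trans h.2)
    · exact hirrP M h.1 h.2.1
    · obtain ⟨hM, hP, hxc⟩ := h
      refine ⟨Or.inl hM.1, hM.2.1, ?_⟩
      have hxM := hdx M ⟨hM.1, hP⟩
      have key : ∀ X ∈ F ∪ deltaC F x, M ⊂ X → x ∈ X := by
        rintro X (hX | ⟨B, hB, rfl⟩) h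
        · exact hxc X ⟨hX, h⟩
        · exact Or.inr rfl
      intro X hX Y hY e
      by_contra hne
      push Not at hne
      apply hxM
      rw [e]
      exact ⟨key X hX (lt_of_le_of_ne (e.le.trans Set.inter_subset_left) hne.1),
        key Y hY (lt_of_le_of_ne (e.le.trans Set.inter_subset_right) hne.2)⟩
    · exact hdup A h.1 h.2.1
    · exact hdup A h.1 h.2.1
    · exact hdup A h.1 h.2.1
    · obtain ⟨hA, -, B, hB, huniq, hcl⟩ := h
      refine ⟨Or.inr ⟨A, hA, rfl⟩, fun h => hdP A hA.2 (by rw [h]; exact Set.subset_univ _), ?_⟩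
      have hxA := hdx A hA
      have key : ∀ X ∈ F ∪ deltaC F x, A ∪ {x} ⊂ X → B ⊆ X := by
        rintro X (hX | ⟨D, hD, rfl⟩) h
        · exact (Set.subset_union_left.trans (subset_clOp_aux F (B ∪ {x}))).trans
            (hcl ▸ clOp_subset_aux hX h.1)
        · have hAD : A ⊆ D := fun a ha => (h.1 (Or.inl ha)).resolve_right
            (fun h' => hxA (by rw [Set.mem_singleton_iff] at h'; exact h' ▸ ha))
          have hne : A ≠ D := by rintro rfl; exact h.2 subset_rfl
          obtain ⟨B', hB', hs⟩ := exists_cover_aux _ A D hD (lt_of_le_of_ne hAD hne)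
          rw [← huniq B' hB']
          exact hs.trans Set.subset_union_left
      intro X hX Y hY e
      by_contra hne
      push Not at hne
      apply hB.2.1.2
      intro a ha
      have : a ∈ A ∪ {x} := by
        rw [e]
        exact ⟨key X hX (lt_of_le_of_ne (e.le.trans Set.inter_subset_left) hne.1) ha,
          key Y hY (lt_of_le_of_ne (e.le.trans Set.inter_subset_right) hne.2) ha⟩
      exact this.resolve_right fun h' => hdx B hB.1
        (by rw [Set.mem_singleton_iff] at h'; exact h' ▸ ha)
end

section
/- Let 𝔽 be a closure system on a finite set S with closure operator Φ, let x ∈ U_Φ, and let F ∈ 𝕄⁶ with unique cover F₁ in Δ_x(𝔽). Then F has exactly one cover F₂ in the closure system 𝔽 that contains Φ_*(x), and moreover F ⊆ F₁, F ⊆ F₂, and Φ_*(x) ⊄ F₁. -/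
/-!
Common framework: the finite ground set `S` is modelled as a finite type `α`;
subsets of `S` are terms of `Set α`, and the full set `S` is `Set.univ`.
-/

universe u

variable {α : Type u}

/-- a member `A` of `𝕄⁶` with unique cover `F₁` in `Δ_x(𝔽)` has
exactly one cover `F₂` in `𝔽` containing `Φ_*(x)`; moreover `A ⊆ F₁`, `A ⊆ F₂`
and `Φ_*(x) ⊄ F₁`. -/
theorem mm6_covers {α : Type u} [Fintype α]
    (F : Set (Set α)) (hF : IsClosureSystem F)
    (x : α) (hx : clOp F {x} ≠ {x})
    (A F1 : Set α) (hA : A ∈ mm6 F x)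
    (hF1 : CoverIn (deltaF F x) A F1)
    (huniq : ∀ C, CoverIn (deltaF F x) A C → C = F1) :
    (∃! F2 : Set α, CoverIn F A F2 ∧ clOp F {x} \ {x} ⊆ F2 ∧ A ⊆ F2) ∧
      A ⊆ F1 ∧ ¬ clOp F {x} \ {x} ⊆ F1 := by
  have hsub := hF1.2.1
  refine ⟨?_, hsub.subset, hF1.1.2⟩
  obtain ⟨hAd, hnm, -⟩ := hA
  have hne : A ≠ Set.univ := by
    rintro rfl
    exact hsub.2 (Set.subset_univ _)
  have key : ∀ X ∈ F, A ⊂ X → ¬ F1 ⊆ X → ∃ C, CoverIn F A C ∧ clOp F {x} \ {x} ⊆ C := by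
    intro X hX hAX hFX
    obtain ⟨C, hC, hmin⟩ := Set.Finite.exists_minimal
      (Set.toFinite {C : Set α | C ∈ F ∧ A ⊂ C ∧ C ⊆ X}) ⟨X, hX, hAX, subset_rfl⟩
    have hcov : CoverIn F A C := by
      refine ⟨hC.1, hC.2.1, ?_⟩
      rintro D hD ⟨h1, h2⟩
      exact h2.2 (hmin ⟨hD, h1, h2.1.trans hC.2.2⟩ h2.1)
    refine ⟨C, hcov, ?_⟩
    by_contra hn
    have : C = F1 := huniq C ⟨⟨hC.1, hn⟩, hC.2.1, fun D hD => hcov.2.2 D hD.1⟩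
    exact hFX (this ▸ hC.2.2)
  have hex : ∃ C, CoverIn F A C ∧ clOp F {x} \ {x} ⊆ C := by
    by_contra hno
    refine hnm ⟨hAd.1, hne, ?_⟩
    intro X hX Y hY hXY
    by_contra hc
    push Not at hc
    have hAX : A ⊂ X := (hXY ▸ Set.inter_subset_left : A ⊆ X).ssubset_of_ne hc.1
    have hAY : A ⊂ Y := (hXY ▸ Set.inter_subset_right : A ⊆ Y).ssubset_of_ne hc.2
    have h1 : F1 ⊆ X := by
      by_contra h
      exact hno (key X hX hAX h)
    have h2 : F1 ⊆ Y := by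
      by_contra h
      exact hno (key Y hY hAY h)
    apply hsub.2
    rw [hXY]
    exact Set.subset_inter h1 h2
  obtain ⟨C, hC, hCx⟩ := hex
  refine ⟨C, ⟨hC, hCx, hC.2.1.subset⟩, ?_⟩
  rintro D ⟨hD, hDx, -⟩
  by_contra hDC
  have hI := hF.2 D hD.1 C hC.1
  have hAI : A ⊂ D ∩ C := by
    refine (Set.subset_inter hD.2.1.subset hC.2.1.subset).ssubset_of_ne ?_
    intro h
    exact hAd.2 (h ▸ Set.subset_inter hDx hCx)
  have e1 : D ∩ C = D := by
    by_contra h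
    exact hD.2.2 _ hI ⟨hAI, Set.inter_subset_left.ssubset_of_ne h⟩
  have e2 : D ∩ C = C := by
    by_contra h
    exact hC.2.2 _ hI ⟨hAI, Set.inter_subset_right.ssubset_of_ne h⟩
  exact hDC (e1.symm.trans e2)
end
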